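/- Let g : ℝⁿ → ℝ be continuously differentiable with g and ∇g of at most polynomial growth, let Λ be an invertible n×n real matrix, and let y ∈ ℝⁿ. Then ∫_{ℝⁿ} g(Λx + y) · x dγₙ(x) = Λᵀ · ∫_{ℝⁿ} ∇g(Λx + y) dγₙ(x). Equivalently, if z is distributed as the Gaussian N(y, ΛΛᵀ), then E[g(z) · Λ^{−1}(z − y)] = Λᵀ · E[∇g(z)]. -/

import Mathlib

open MeasureTheory Real Matrix

/-- The standard Gaussian measure on `ℝⁿ`, with density `(2π)^{−n/2} exp(−‖x‖²/2)` with
respect to Lebesgue measure. -/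
noncomputable def stdGaussian (n : ℕ) : Measure (EuclideanSpace ℝ (Fin n)) :=
  volume.withDensity fun x =>
    ENNReal.ofReal ((2 * π) ^ (-(n : ℝ) / 2) * Real.exp (-‖x‖ ^ 2 / 2))

/-- A function has at most polynomial growth if `‖f(x)‖ ≤ C(1 + ‖x‖)^r` for some `C > 0`
and some natural number `r`. -/
def PolyGrowth {E F : Type*} [NormedAddCommGroup E] [NormedAddCommGroup F] (f : E → F) : Prop :=
  ∃ C > (0 : ℝ), ∃ r : ℕ, ∀ x, ‖f x‖ ≤ C * (1 + ‖x‖) ^ r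

namespace PolyGrowth

variable {E E' F F' : Type*} [NormedAddCommGroup E] [NormedAddCommGroup E']
  [NormedAddCommGroup F] [NormedAddCommGroup F']

protected theorem id : PolyGrowth (fun x : E => x) :=
  ⟨1, one_pos, 1, fun x => by simp⟩

theorem smul [NormedSpace ℝ F] {f : E → ℝ} {g : E → F} (hf : PolyGrowth f) (hg : PolyGrowth g) :
    PolyGrowth (fun x => f x • g x) := by
  obtain ⟨C, hC, r, hf⟩ := hf
  obtain ⟨D, hD, s, hg⟩ := hg
  refine ⟨C * D, by positivity, r + s, fun x => ?_⟩
  calc ‖f x • g x‖ = ‖f x‖ * ‖g x‖ := norm_smul _ _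
    _ ≤ (C * (1 + ‖x‖) ^ r) * (D * (1 + ‖x‖) ^ s) := by
      gcongr
      exacts [hf x, hg x]
    _ = C * D * (1 + ‖x‖) ^ (r + s) := by ring

theorem clm_comp [NormedSpace ℝ F] [NormedSpace ℝ F'] {f : E → F} (hf : PolyGrowth f)
    (T : F →L[ℝ] F') : PolyGrowth (fun x => T (f x)) := by
  obtain ⟨C, hC, r, hf⟩ := hf
  refine ⟨(‖T‖ + 1) * C, by positivity, r, fun x => ?_⟩
  calc ‖T (f x)‖ ≤ ‖T‖ * ‖f x‖ := T.le_opNorm _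
    _ ≤ (‖T‖ + 1) * (C * (1 + ‖x‖) ^ r) := by
      gcongr
      exacts [by linarith, hf x]
    _ = (‖T‖ + 1) * C * (1 + ‖x‖) ^ r := by ring

theorem comp_affine [NormedSpace ℝ E] [NormedSpace ℝ E'] {f : E' → F} (hf : PolyGrowth f)
    (L : E →L[ℝ] E') (y : E') : PolyGrowth (fun x => f (L x + y)) := by
  obtain ⟨C, hC, r, hf⟩ := hf
  refine ⟨C * (1 + ‖L‖ + ‖y‖) ^ r, by positivity, r, fun x => ?_⟩
  have hL : ‖L x + y‖ ≤ ‖L‖ * ‖x‖ + ‖y‖ := (norm_add_le _ _).trans (by gcongr; exact L.le_opNorm x)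
  have key : 1 + ‖L x + y‖ ≤ (1 + ‖L‖ + ‖y‖) * (1 + ‖x‖) := by
    nlinarith [norm_nonneg L, norm_nonneg x, norm_nonneg y,
      mul_nonneg (norm_nonneg y) (norm_nonneg x)]
  calc ‖f (L x + y)‖ ≤ C * (1 + ‖L x + y‖) ^ r := hf _
    _ ≤ C * ((1 + ‖L‖ + ‖y‖) * (1 + ‖x‖)) ^ r := by gcongr
    _ = C * (1 + ‖L‖ + ‖y‖) ^ r * (1 + ‖x‖) ^ r := by rw [mul_pow]; ring

end PolyGrowth

theorem pow_mul_exp_neg_sq_half_le (k : ℕ) {t : ℝ} (ht : 0 ≤ t) :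
    (1 + t) ^ k * Real.exp (-t ^ 2 / 2) ≤ k.factorial * Real.exp (3 / 2) := by
  have hpow : (1 + t) ^ k ≤ k.factorial * Real.exp (1 + t) := by
    have := Real.pow_div_factorial_le_exp (x := 1 + t) (by positivity) k
    rwa [div_le_iff₀' (by positivity)] at this
  calc (1 + t) ^ k * Real.exp (-t ^ 2 / 2)
      ≤ (k.factorial * Real.exp (1 + t)) * Real.exp (-t ^ 2 / 2) := by gcongr
    _ = k.factorial * Real.exp (1 + t + -t ^ 2 / 2) := by rw [mul_assoc, ← Real.exp_add]
    _ ≤ k.factorial * Real.exp (3 / 2) := by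
      gcongr
      nlinarith [sq_nonneg (t - 1)]

theorem hasFDerivAt_exp_neg_norm_sq_half {E : Type*} [NormedAddCommGroup E]
    [InnerProductSpace ℝ E] (x : E) :
    HasFDerivAt (fun x : E => Real.exp (-‖x‖ ^ 2 / 2))
      (-(Real.exp (-‖x‖ ^ 2 / 2) • innerSL ℝ x)) x := by
  have h := (((hasStrictFDerivAt_norm_sq x).hasFDerivAt.neg).mul_const (2⁻¹ : ℝ)).exp
  simp only [← div_eq_mul_inv, Pi.neg_apply] at h
  refine h.congr_fderiv ?_
  ext v
  simp

section Gaussian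

variable {E F : Type*} [NormedAddCommGroup E] [InnerProductSpace ℝ E] [FiniteDimensional ℝ E]
  [MeasurableSpace E] [BorelSpace E] [NormedAddCommGroup F] [NormedSpace ℝ F]

theorem PolyGrowth.integrable_exp_smul {f : E → F} (hf : PolyGrowth f) (hc : Continuous f) :
    Integrable (fun x => Real.exp (-‖x‖ ^ 2 / 2) • f x) := by
  obtain ⟨C, hC, r, hf⟩ := hf
  set d := Module.finrank ℝ E + 1
  have hint : Integrable (fun x : E => (1 + ‖x‖) ^ (-(d : ℝ))) :=
    integrable_one_add_norm (by simp [d])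
  refine (hint.const_mul (C * ((r + d).factorial * Real.exp (3 / 2)))).mono'
    (by fun_prop) (.of_forall fun x => ?_)
  have hpos : 0 < (1 + ‖x‖) ^ d := by positivity
  rw [norm_smul, Real.norm_of_nonneg (Real.exp_nonneg _), Real.rpow_neg (by positivity),
    Real.rpow_natCast, ← div_eq_mul_inv, le_div_iff₀ hpos]
  calc Real.exp (-‖x‖ ^ 2 / 2) * ‖f x‖ * (1 + ‖x‖) ^ d
      ≤ Real.exp (-‖x‖ ^ 2 / 2) * (C * (1 + ‖x‖) ^ r) * (1 + ‖x‖) ^ d := by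
        gcongr
        exact hf x
    _ = C * ((1 + ‖x‖) ^ (r + d) * Real.exp (-‖x‖ ^ 2 / 2)) := by ring
    _ ≤ C * ((r + d).factorial * Real.exp (3 / 2)) :=
        mul_le_mul_of_nonneg_left (pow_mul_exp_neg_sq_half_le _ (norm_nonneg x)) hC.le

/-- Gaussian integration by parts in a fixed direction, for an unnormalized Gaussian weight. -/
theorem integral_exp_mul_inner_eq_integral_exp_mul_fderiv {h : E → ℝ} (hh : ContDiff ℝ 1 h)
    (v : E) (hgrow : PolyGrowth h) (hgrow' : PolyGrowth (fun x => fderiv ℝ h x v)) :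
    ∫ x, Real.exp (-‖x‖ ^ 2 / 2) * (h x * inner ℝ x v)
      = ∫ x, Real.exp (-‖x‖ ^ 2 / 2) * fderiv ℝ h x v := by
  have hφ (x : E) : fderiv ℝ (fun x : E => Real.exp (-‖x‖ ^ 2 / 2)) x v
      = -(Real.exp (-‖x‖ ^ 2 / 2) * inner ℝ x v) := by
    simp [(hasFDerivAt_exp_neg_norm_sq_half x).fderiv]
  have hinner : PolyGrowth (fun x : E => inner ℝ x v) := by
    simpa [real_inner_comm] using PolyGrowth.id.clm_comp (innerSL ℝ v)
  have hcont : Continuous h := hh.continuous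
  have hcont' : Continuous (fun x => fderiv ℝ h x v) :=
    (hh.continuous_fderiv one_ne_zero).clm_apply continuous_const
  have h₁ := (hgrow.smul hinner).integrable_exp_smul (by fun_prop)
  have h₂ := hgrow'.integrable_exp_smul hcont'
  have h₃ := hgrow.integrable_exp_smul hcont
  simp only [smul_eq_mul] at h₁ h₂ h₃
  rw [integral_mul_fderiv_eq_neg_fderiv_mul_of_integrable _ h₂ h₃
    (fun x _ => (hasFDerivAt_exp_neg_norm_sq_half x).differentiableAt)
    (fun x _ => hh.differentiable one_ne_zero x), ← integral_neg]
  · refine integral_congr_ae (.of_forall fun x => ?_)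
    simp only [hφ]
    ring
  · refine h₁.neg.congr (.of_forall fun x => ?_)
    simp only [hφ, Pi.neg_apply]
    ring

end Gaussian

section StdGaussian

variable {n : ℕ} {F : Type*} [NormedAddCommGroup F] [NormedSpace ℝ F]

theorem integral_stdGaussian (f : EuclideanSpace ℝ (Fin n) → F) :
    ∫ x, f x ∂(stdGaussian n)
      = (2 * π) ^ (-(n : ℝ) / 2) • ∫ x, Real.exp (-‖x‖ ^ 2 / 2) • f x := by
  rw [stdGaussian, integral_withDensity_eq_integral_toReal_smul (by fun_prop) (by simp),
    ← integral_smul]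
  refine integral_congr_ae (.of_forall fun x => ?_)
  simp only
  rw [ENNReal.toReal_ofReal (by positivity), mul_smul]

theorem PolyGrowth.integrable_stdGaussian {f : EuclideanSpace ℝ (Fin n) → F} (hf : PolyGrowth f)
    (hc : Continuous f) : Integrable f (stdGaussian n) := by
  rw [stdGaussian, integrable_withDensity_iff_integrable_smul' (by fun_prop) (by simp)]
  refine ((hf.integrable_exp_smul hc).smul ((2 * π) ^ (-(n : ℝ) / 2))).congr
    (.of_forall fun x => ?_)
  simp only [Pi.smul_apply]
  rw [ENNReal.toReal_ofReal (by positivity), mul_smul]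

end StdGaussian

/-- First-order Gaussian integration by parts for an affine change of variables: if `z` is
distributed as `N(y, ΛΛᵀ)`, i.e. `z = Λx + y` with `x` standard Gaussian, then
`∫ g(Λx + y)·x dγₙ(x) = Λᵀ · ∫ ∇g(Λx + y) dγₙ(x)`. -/
theorem firstOrder_fourierHermite_coefficient_affine (n : ℕ)
    (g : EuclideanSpace ℝ (Fin n) → ℝ) (hg : ContDiff ℝ 1 g)
    (hgrow : PolyGrowth g) (hgrow' : PolyGrowth (gradient g))
    (Λ : Matrix (Fin n) (Fin n) ℝ) (hΛ : IsUnit Λ.det) (y : EuclideanSpace ℝ (Fin n)) :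
    ∫ x, g (Matrix.toEuclideanLin Λ x + y) • x ∂(stdGaussian n)
      = Matrix.toEuclideanLin Λᵀ
          (∫ x, gradient g (Matrix.toEuclideanLin Λ x + y) ∂(stdGaussian n)) := by
  set L : EuclideanSpace ℝ (Fin n) →L[ℝ] EuclideanSpace ℝ (Fin n) :=
    LinearMap.toContinuousLinearMap (Matrix.toEuclideanLin Λ)
  have hΛL (x : EuclideanSpace ℝ (Fin n)) : Matrix.toEuclideanLin Λ x = L x := rfl
  have hadj (u v : EuclideanSpace ℝ (Fin n)) :
      inner ℝ v (Matrix.toEuclideanLin Λᵀ u) = inner ℝ (L v) u := by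
    rw [← Matrix.conjTranspose_eq_transpose_of_trivial,
      Matrix.toEuclideanLin_conjTranspose_eq_adjoint, LinearMap.adjoint_inner_right, hΛL]
  have hgrad : Continuous (gradient g) :=
    (InnerProductSpace.toDual ℝ _).symm.continuous.comp (hg.continuous_fderiv one_ne_zero)
  have hgL := hgrow.comp_affine L y
  have hcontL : Continuous (fun x => g (L x + y)) := hg.continuous.comp (by fun_prop)
  have hgradL := hgrow'.comp_affine L y
  have hfderiv (x v : EuclideanSpace ℝ (Fin n)) :
      fderiv ℝ (fun x => g (L x + y)) x v = inner ℝ (L v) (gradient g (L x + y)) := by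
    have h := (hg.differentiable one_ne_zero (L x + y)).hasFDerivAt.comp x
      (L.hasFDerivAt.add_const y)
    simpa [Function.comp_def] using DFunLike.congr_fun h.fderiv v
  simp only [hΛL]
  refine ext_inner_left ℝ fun v => ?_
  rw [hadj, ← integral_inner ((hgL.smul .id).integrable_stdGaussian (by fun_prop)),
    ← integral_inner (hgradL.integrable_stdGaussian (by fun_prop)),
    integral_stdGaussian, integral_stdGaussian]
  have hstein := integral_exp_mul_inner_eq_integral_exp_mul_fderiv
    (h := fun x => g (L x + y)) (hg.comp (by fun_prop)) v hgL
    (by simpa only [hfderiv, innerSL_apply_apply] using hgradL.clm_comp (innerSL ℝ (L v)))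
  simp only [hfderiv] at hstein
  simp only [smul_eq_mul, inner_smul_right, ← hstein, real_inner_comm v]
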